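/- arXiv:1103.1834 — 2 statements merged into one kernel-verified Lean document; each statement's English description precedes it below -/
import Mathlib

section
/- Let C be a set of clusters on a finite taxa set X and let U be the union of the clusters belonging to a connected component of the incompatibility graph IG(C). Then U is unseparated with respect to C. -/
open scoped Classical

namespace Phylo

variable {α : Type} [DecidableEq α]

/-- A finite directed graph whose vertices carry labels from `α`; used to model
rooted phylogenetic networks and trees. -/
structure Net (α : Type) where
  n : ℕ
  E : Finset (Fin n × Fin n)
  label : Fin n → α

namespace Net

def indeg (N : Net α) (v : Fin N.n) : ℕ := (N.E.filter fun e => e.2 = v).card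

def outdeg (N : Net α) (v : Fin N.n) : ℕ := (N.E.filter fun e => e.1 = v).card

def Adj (N : Net α) (u v : Fin N.n) : Prop := (u, v) ∈ N.E

def Reaches (N : Net α) : Fin N.n → Fin N.n → Prop := Relation.ReflTransGen N.Adj

def IsLeaf (N : Net α) (v : Fin N.n) : Prop := N.outdeg v = 0

/-- The set of labels of leaves reachable from `v` by directed paths. -/
noncomputable def clusterBelow (N : Net α) (v : Fin N.n) : Finset α :=
  (Finset.univ.filter fun w => N.Reaches v w ∧ N.IsLeaf w).image N.label

/-- The reticulation number `r(N) = Σ_{v : indeg(v) > 0} (indeg(v) - 1)`. -/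
def reticNum (N : Net α) : ℕ := ∑ v, (N.indeg v - 1)

end Net

/-- `N` is a rooted phylogenetic network on the taxa set `X`: an acyclic digraph with a
unique root (indegree-0 node), no node with indegree 1 and outdegree 1, every
reticulation (indegree ≥ 2) having outdegree ≥ 1, and leaves bijectively labeled by `X`. -/
def IsPhyloNet (X : Finset α) (N : Net α) : Prop :=
  (∀ v : Fin N.n, ¬ Relation.TransGen N.Adj v v) ∧
  (∃! ρ : Fin N.n, N.indeg ρ = 0) ∧
  (∀ v : Fin N.n, ¬ (N.indeg v = 1 ∧ N.outdeg v = 1)) ∧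
  (∀ v : Fin N.n, 2 ≤ N.indeg v → 1 ≤ N.outdeg v) ∧
  Set.BijOn N.label {v | N.IsLeaf v} (X : Set α)

/-- A rooted phylogenetic tree on `X` is a network on `X` with reticulation number 0. -/
def IsPhyloTree (X : Finset α) (N : Net α) : Prop := IsPhyloNet X N ∧ N.reticNum = 0

/-- A network is binary if every reticulation has indegree 2 and outdegree 1 and every
non-leaf tree node has outdegree 2. -/
def IsBinary (N : Net α) : Prop :=
  ∀ v : Fin N.n, (N.indeg v ≤ 1 → N.outdeg v = 0 ∨ N.outdeg v = 2) ∧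
    (2 ≤ N.indeg v → N.indeg v = 2 ∧ N.outdeg v = 1)

/-- The internal vertices of a path given as a list of vertices. -/
def internals {β : Type*} (p : List β) : List β := p.tail.dropLast

def IsDirPath (N : Net α) (u v : Fin N.n) (p : List (Fin N.n)) : Prop :=
  p.head? = some u ∧ p.getLast? = some v ∧ p.Chain' N.Adj ∧ 2 ≤ p.length

/-- `N` displays `T`: `T` can be obtained from `N` by deleting nodes and edges and
suppressing indegree-1 outdegree-1 nodes, formalized as a topological embedding:
each edge of `T` maps to a directed path of `N`, paths being internally disjoint
from each other and from the images of the nodes of `T`, and leaves of `T` map to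
leaves of `N` with the same label. -/
def Displays (N T : Net α) : Prop :=
  ∃ φ : Fin T.n → Fin N.n, Function.Injective φ ∧
    (∀ v, T.IsLeaf v → N.IsLeaf (φ v) ∧ N.label (φ v) = T.label v) ∧
    ∃ P : Fin T.n × Fin T.n → List (Fin N.n),
      (∀ e ∈ T.E, IsDirPath N (φ e.1) (φ e.2) (P e)) ∧
      (∀ e ∈ T.E, ∀ w ∈ internals (P e), w ∉ Set.range φ) ∧
      (∀ e ∈ T.E, ∀ f ∈ T.E, e ≠ f → ∀ w ∈ internals (P e), w ∉ internals (P f))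

/-- `N` represents the cluster `C` in the softwired sense: some tree on `X` displayed by
`N` has an edge whose set of leaf descendants is exactly `C`. -/
def RepresentsCluster (X : Finset α) (N : Net α) (C : Finset α) : Prop :=
  ∃ T : Net α, IsPhyloTree X T ∧ Displays N T ∧ ∃ e ∈ T.E, T.clusterBelow e.2 = C

def RepresentsSet (X : Finset α) (N : Net α) (𝒞 : Set (Finset α)) : Prop :=
  ∀ C ∈ 𝒞, RepresentsCluster X N C

/-- `Cl(T)`: the set of clusters represented by edges of the tree `T`. -/
def clSet (T : Net α) : Set (Finset α) := {C | ∃ e ∈ T.E, T.clusterBelow e.2 = C}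

/-- `r(𝒞)`: the minimum reticulation number of a network on `X` representing `𝒞`. -/
noncomputable def rNum (X : Finset α) (𝒞 : Set (Finset α)) : ℕ :=
  sInf {k | ∃ N : Net α, IsPhyloNet X N ∧ RepresentsSet X N 𝒞 ∧ N.reticNum = k}

/-- A cluster on `X` is a nonempty proper subset of `X`. -/
def IsCluster (X C : Finset α) : Prop := C ⊆ X ∧ C.Nonempty ∧ C ≠ X

def IsClusterSet (X : Finset α) (𝒞 : Set (Finset α)) : Prop := ∀ C ∈ 𝒞, IsCluster X C

def Compatible (A B : Finset α) : Prop := A ∩ B = ∅ ∨ A ⊆ B ∨ B ⊆ A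

/-- `𝒞 \ S`: remove the elements of `S` from each cluster, discarding emptied clusters. -/
def removeTaxa (𝒞 : Set (Finset α)) (S : Finset α) : Set (Finset α) :=
  {D | D.Nonempty ∧ ∃ C ∈ 𝒞, D = C \ S}

/-- `𝒞 | S`: the restriction of `𝒞` to `S`. -/
def restrictTo (𝒞 : Set (Finset α)) (S : Finset α) : Set (Finset α) :=
  {D | D.Nonempty ∧ ∃ C ∈ 𝒞, D = C ∩ S}

/-- `S` is unseparated by `𝒞`: no cluster of `𝒞` is incompatible with `S`. -/
def Unseparated (𝒞 : Set (Finset α)) (S : Finset α) : Prop := ∀ C ∈ 𝒞, Compatible C S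

/-- `𝒞` separates every proper subset of `X` with at least two elements. -/
def Separating (X : Finset α) (𝒞 : Set (Finset α)) : Prop :=
  ∀ X' : Finset α, X' ⊂ X → 2 ≤ X'.card → ∃ C ∈ 𝒞, ¬ Compatible C X'

def PairwiseCompatible (𝒞 : Set (Finset α)) : Prop := ∀ A ∈ 𝒞, ∀ B ∈ 𝒞, Compatible A B

/-- `S` is an ST-set with respect to `𝒞`. -/
def IsSTSet (X : Finset α) (𝒞 : Set (Finset α)) (S : Finset α) : Prop :=
  S ⊆ X ∧ Unseparated 𝒞 S ∧ PairwiseCompatible (restrictTo 𝒞 S)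

/-- `S` is a maximal ST-set: no ST-set properly contains it. -/
def IsMaxSTSet (X : Finset α) (𝒞 : Set (Finset α)) (S : Finset α) : Prop :=
  IsSTSet X 𝒞 S ∧ ∀ S', IsSTSet X 𝒞 S' → ¬ S ⊂ S'

/-- `(S₁, …, S_p)` is a maximal ST-set sequence of `𝒞`. -/
def IsMaxSTSeq : Finset α → Set (Finset α) → List (Finset α) → Prop
  | _, _, [] => True
  | X, 𝒞, S :: L => IsMaxSTSet X 𝒞 S ∧ IsMaxSTSeq (X \ S) (removeTaxa 𝒞 S) L

/-- `(S₁, …, S_p)` is an ST-set sequence of `𝒞` (empty ST-sets allowed). -/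
def IsSTSeq : Finset α → Set (Finset α) → List (Finset α) → Prop
  | _, _, [] => True
  | X, 𝒞, S :: L => IsSTSet X 𝒞 S ∧ IsSTSeq (X \ S) (removeTaxa 𝒞 S) L

def removeAll (𝒞 : Set (Finset α)) (L : List (Finset α)) : Set (Finset α) :=
  L.foldl removeTaxa 𝒞

/-- A maximal ST-set *tree* sequence: additionally the remaining clusters are pairwise
compatible. -/
def IsMaxSTTreeSeq (X : Finset α) (𝒞 : Set (Finset α)) (L : List (Finset α)) : Prop :=
  IsMaxSTSeq X 𝒞 L ∧ PairwiseCompatible (removeAll 𝒞 L)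

def IsSTTreeSeq (X : Finset α) (𝒞 : Set (Finset α)) (L : List (Finset α)) : Prop :=
  IsSTSeq X 𝒞 L ∧ PairwiseCompatible (removeAll 𝒞 L)

/-- The MST lower bound: minimum length of a maximal ST-set tree sequence of `𝒞`. -/
noncomputable def mstLB (X : Finset α) (𝒞 : Set (Finset α)) : ℕ :=
  sInf {p | ∃ L, IsMaxSTTreeSeq X 𝒞 L ∧ L.length = p}

/- Underlying undirected notions, biconnected components and the level of a network. -/

def uadj (N : Net α) (F : Finset (Fin N.n × Fin N.n)) (u v : Fin N.n) : Prop :=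
  (u, v) ∈ F ∨ (v, u) ∈ F

def verts (N : Net α) (F : Finset (Fin N.n × Fin N.n)) : Finset (Fin N.n) :=
  F.image Prod.fst ∪ F.image Prod.snd

def ConnOn (N : Net α) (F : Finset (Fin N.n × Fin N.n)) : Prop :=
  ∀ u ∈ verts N F, ∀ v ∈ verts N F, Relation.ReflTransGen (uadj N F) u v

def delVert (N : Net α) (F : Finset (Fin N.n × Fin N.n)) (v : Fin N.n) :
    Finset (Fin N.n × Fin N.n) :=
  F.filter fun e => e.1 ≠ v ∧ e.2 ≠ v

def HasCutNodeOn (N : Net α) (F : Finset (Fin N.n × Fin N.n)) : Prop :=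
  ∃ v ∈ verts N F, ∃ a ∈ verts N F, ∃ b ∈ verts N F, a ≠ v ∧ b ≠ v ∧
    ¬ Relation.ReflTransGen (uadj N (delVert N F v)) a b

/-- The (edge set of a) subgraph is biconnected: connected and without cut-nodes. -/
def Biconn (N : Net α) (F : Finset (Fin N.n × Fin N.n)) : Prop :=
  F.Nonempty ∧ ConnOn N F ∧ ¬ HasCutNodeOn N F

/-- `F` is a biconnected component of `N`: a maximal biconnected subgraph. -/
def IsBCC (N : Net α) (F : Finset (Fin N.n × Fin N.n)) : Prop :=
  F ⊆ N.E ∧ Biconn N F ∧ ∀ F', F' ⊆ N.E → Biconn N F' → F ⊆ F' → F' = F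

/-- Reticulation number of a biconnected component, indegrees computed within it. -/
def compRetic (N : Net α) (F : Finset (Fin N.n × Fin N.n)) : ℕ :=
  ∑ v ∈ verts N F, ((F.filter fun e => e.2 = v).card - 1)

/-- The level of `N`: the maximum reticulation number of a biconnected component. -/
noncomputable def level (N : Net α) : ℕ :=
  sSup {k | ∃ F, IsBCC N F ∧ compRetic N F = k}

def IsCutEdge (N : Net α) (e : Fin N.n × Fin N.n) : Prop :=
  e ∈ N.E ∧ ∃ a b : Fin N.n, ¬ Relation.ReflTransGen (uadj N (N.E.erase e)) a b

def IsCutNode (N : Net α) (v : Fin N.n) : Prop :=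
  ∃ a b : Fin N.n, a ≠ v ∧ b ≠ v ∧
    ¬ Relation.ReflTransGen (uadj N (delVert N N.E v)) a b

/-- `N` is simple: removal of any cut-node or cut-edge leaves at most one non-trivial
connected component (all remaining edges lie in a single component). -/
def IsSimpleNet (N : Net α) : Prop :=
  (∀ v : Fin N.n, IsCutNode N v → ∀ f ∈ delVert N N.E v, ∀ g ∈ delVert N N.E v,
      Relation.ReflTransGen (uadj N (delVert N N.E v)) f.1 g.1) ∧
  (∀ e : Fin N.n × Fin N.n, IsCutEdge N e → ∀ f ∈ N.E.erase e, ∀ g ∈ N.E.erase e,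
      Relation.ReflTransGen (uadj N (N.E.erase e)) f.1 g.1)

/-- The non-trivial ST-set `S` is under a cut-edge of `N`: `N` has a cut-edge `(u,v)`
such that the subnetwork rooted at `v` is a tree whose taxa set is `S` and which
represents the cluster set `𝒞 | S`. -/
def UnderCutEdge (𝒞 : Set (Finset α)) (N : Net α) (S : Finset α) : Prop :=
  ∃ e ∈ N.E, IsCutEdge N e ∧ N.clusterBelow e.2 = S ∧
    (∀ w : Fin N.n, N.Reaches e.2 w →
      (N.E.filter fun f => f.2 = w ∧ N.Reaches e.2 f.1).card ≤ 1) ∧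
    ∀ C ∈ restrictTo 𝒞 S, ∃ f ∈ N.E, N.Reaches e.2 f.1 ∧ N.clusterBelow f.2 = C

/-- The subnetwork of `N` rooted at `v` is exactly (isomorphic to) `T`. -/
def IsoSubnetAt (N : Net α) (v : Fin N.n) (T : Net α) : Prop :=
  ∃ g : Fin T.n → Fin N.n, Function.Injective g ∧
    Set.range g = {w | N.Reaches v w} ∧
    (∀ a b : Fin T.n, (a, b) ∈ T.E ↔ (g a, g b) ∈ N.E) ∧
    ∀ a : Fin T.n, T.IsLeaf a → N.label (g a) = T.label a

/-- `T` is a subtree below a reticulation (SBR) of `N`. -/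
def IsSBR (N T : Net α) : Prop :=
  ∃ v : Fin N.n, 2 ≤ N.indeg v ∧
    (∀ w : Fin N.n, N.Reaches v w → w ≠ v → N.indeg w < 2) ∧
    ((N.outdeg v = 1 ∧ ∃ c : Fin N.n, (v, c) ∈ N.E ∧ IsoSubnetAt N c T) ∨
     (N.outdeg v ≠ 1 ∧ IsoSubnetAt N v T))

/-- `T'` is a (not necessarily binary) refinement of `T`: a tree on `X` with
`Cl(T) ⊆ Cl(T')`. -/
def IsRefinement (X : Finset α) (T T' : Net α) : Prop :=
  IsPhyloTree X T' ∧ clSet T ⊆ clSet T'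

/-- `h⁰(𝒯)`: minimum reticulation number of a network on `X` displaying some
refinement of each tree of the family. -/
noncomputable def h0 (X : Finset α) {m : ℕ} (T : Fin m → Net α) : ℕ :=
  sInf {k | ∃ N : Net α, IsPhyloNet X N ∧
    (∀ i, ∃ T', IsRefinement X (T i) T' ∧ Displays N T') ∧ N.reticNum = k}

/-- `h⁻(𝒯)`: minimum reticulation number of a network on `X` displaying some *binary*
refinement of each tree of the family. -/
noncomputable def hminus (X : Finset α) {m : ℕ} (T : Fin m → Net α) : ℕ :=
  sInf {k | ∃ N : Net α, IsPhyloNet X N ∧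
    (∀ i, ∃ T', IsRefinement X (T i) T' ∧ IsBinary T' ∧ Displays N T') ∧ N.reticNum = k}

/-- `N` is consistent with the rooted triplet `xy|z`: it displays the binary tree on
`{x,y,z}` in which `{x,y}` is a cluster. -/
def ConsistentTriplet (N : Net α) (x y z : α) : Prop :=
  ∃ t : Net α, IsPhyloTree ({x, y, z} : Finset α) t ∧ IsBinary t ∧
    (∃ e ∈ t.E, t.clusterBelow e.2 = ({x, y} : Finset α)) ∧ Displays N t

/-- `r_tr(𝒯)`: minimum reticulation number of a network on `X` consistent with every
rooted triplet consistent with some tree of the family. -/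
noncomputable def rtr (X : Finset α) {m : ℕ} (T : Fin m → Net α) : ℕ :=
  sInf {k | ∃ N : Net α, IsPhyloNet X N ∧
    (∀ x y z : α, x ≠ y → y ≠ z → x ≠ z →
      (∃ i, ConsistentTriplet (T i) x y z) → ConsistentTriplet N x y z) ∧
    N.reticNum = k}

/-- `𝒞_{U → u}`: replace all elements of `U` in every cluster by the single taxon `u`. -/
def collapseTo (𝒞 : Set (Finset α)) (U : Finset α) (u : α) : Set (Finset α) :=
  {D | ∃ C ∈ 𝒞, D = if (C ∩ U).Nonempty then (C \ U) ∪ {u} else C}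

/-- The union of the clusters in a connected component of the
incompatibility graph `IG(𝒞)` is unseparated with respect to `𝒞`. -/
theorem union_of_IG_component_unseparated {α : Type} [DecidableEq α] (X : Finset α)
    (𝒞 : Set (Finset α)) (h𝒞 : IsClusterSet X 𝒞)
    (C₀ : Finset α) (hC₀ : C₀ ∈ 𝒞) (U : Finset α)
    (hU : ∀ x : α, x ∈ U ↔ ∃ C : Finset α,
      (C ∈ 𝒞 ∧ Relation.ReflTransGen
        (fun A B : Finset α => A ∈ 𝒞 ∧ B ∈ 𝒞 ∧ ¬ Compatible A B) C₀ C) ∧ x ∈ C) :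
    Unseparated 𝒞 U := by
  intro D hD
  by_cases h : ∃ C, (C ∈ 𝒞 ∧ Relation.ReflTransGen
        (fun A B : Finset α => A ∈ 𝒞 ∧ B ∈ 𝒞 ∧ ¬ Compatible A B) C₀ C) ∧ D ⊆ C
  · obtain ⟨C, hC, hDC⟩ := h
    exact Or.inr (Or.inl fun x hx => (hU x).2 ⟨C, hC, hDC hx⟩)
  have key : ∀ C, C ∈ 𝒞 → Relation.ReflTransGen
        (fun A B : Finset α => A ∈ 𝒞 ∧ B ∈ 𝒞 ∧ ¬ Compatible A B) C₀ C →
        (C ∩ D = ∅ ∨ C ⊆ D) := by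
    intro C hC hr
    by_contra hn
    by_cases hc : Compatible C D
    · rcases hc with hc | hc | hc
      · exact hn (Or.inl hc)
      · exact hn (Or.inr hc)
      · exact h ⟨C, ⟨hC, hr⟩, hc⟩
    · exact h ⟨D, ⟨hD, hr.tail ⟨hC, hD, hc⟩⟩, Finset.Subset.refl D⟩
  rcases key C₀ hC₀ Relation.ReflTransGen.refl with h0 | h0
  · have all : ∀ C, Relation.ReflTransGen
        (fun A B : Finset α => A ∈ 𝒞 ∧ B ∈ 𝒞 ∧ ¬ Compatible A B) C₀ C → C ∩ D = ∅ := by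
      intro C hr
      induction hr with
      | refl => exact h0
      | @tail A B hA hAB ih =>
        rcases key B hAB.2.1 (hA.tail hAB) with hB | hB
        · exact hB
        · exfalso
          apply hAB.2.2
          left
          ext x
          have e := Finset.ext_iff.1 ih x
          have := @hB x
          simp only [Finset.mem_inter, Finset.notMem_empty, iff_false] at e ⊢
          tauto
    left
    ext x
    simp only [Finset.mem_inter, Finset.notMem_empty, iff_false, not_and]
    intro hx hxU
    obtain ⟨C, ⟨_, hr⟩, hxC⟩ := (hU x).1 hxU
    have e := Finset.ext_iff.1 (all C hr) x
    simp only [Finset.mem_inter, Finset.notMem_empty, iff_false] at e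
    exact e ⟨hxC, hx⟩
  · have all : ∀ C, Relation.ReflTransGen
        (fun A B : Finset α => A ∈ 𝒞 ∧ B ∈ 𝒞 ∧ ¬ Compatible A B) C₀ C → C ⊆ D := by
      intro C hr
      induction hr with
      | refl => exact h0
      | @tail A B hA hAB ih =>
        rcases key B hAB.2.1 (hA.tail hAB) with hB | hB
        · exfalso
          apply hAB.2.2
          left
          ext x
          have e := Finset.ext_iff.1 hB x
          have := @ih x
          simp only [Finset.mem_inter, Finset.notMem_empty, iff_false] at e ⊢
          tauto
        · exact hB
    right; right
    intro x hxU
    obtain ⟨C, ⟨_, hr⟩, hxC⟩ := (hU x).1 hxU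
    exact all C hr hxC

end Phylo
end

section
/- Let T = {T_1, ..., T_m} be a set of (not necessarily binary) rooted phylogenetic trees on a finite taxa set X, and let X' with ∅ ⊂ X' ⊂ X be an unseparated set with respect to Cl(T). Then for each T_i ∈ T there exists an edge e_i or a node v_i in T_i that represents X'. -/
open scoped Classical

namespace Phylo

variable {α : Type} [DecidableEq α]

theorem aux_root {X : Finset α} {N : Net α} (h : IsPhyloNet X N) :
    ∃ ρ : Fin N.n, (∀ w, N.Reaches ρ w) ∧ ∀ v, N.indeg v = 0 → v = ρ := by
  obtain ⟨hac, ⟨ρ, hρ, huniq⟩, -⟩ := h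
  refine ⟨ρ, ?_, huniq⟩
  have : Std.Irrefl (Relation.TransGen N.Adj) := ⟨hac⟩
  have wf : WellFounded (Relation.TransGen N.Adj) := Finite.wellFounded_of_trans_of_irrefl _
  intro w
  induction w using wf.induction with
  | _ w ih =>
    by_cases h0 : N.indeg w = 0
    · rw [huniq w h0]; exact Relation.ReflTransGen.refl
    · obtain ⟨e, he⟩ := Finset.card_pos.1 (Nat.pos_of_ne_zero h0)
      rw [Finset.mem_filter] at he
      obtain ⟨he, rfl⟩ := he
      have ha : N.Adj e.1 e.2 := he
      exact (ih e.1 (Relation.TransGen.single ha)).tail ha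

theorem mem_clusterBelow {N : Net α} {v : Fin N.n} {x : α} :
    x ∈ N.clusterBelow v ↔ ∃ w, (N.Reaches v w ∧ N.IsLeaf w) ∧ N.label w = x := by
  simp [Net.clusterBelow]

/-- If `X'` (with `∅ ⊂ X' ⊂ X`) is unseparated with respect to
`Cl(𝒯)` for a set `𝒯` of trees on `X`, then each tree of `𝒯` has an edge or a node
representing `X'` (a node represents `X'` if `X'` is the union of the clusters of a
subset of its outgoing edges). -/
theorem unseparated_represented_in_each_tree {α : Type} [DecidableEq α] (X : Finset α)
    (m : ℕ) (T : Fin m → Net α) (hT : ∀ i, IsPhyloTree X (T i))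
    (X' : Finset α) (hne : X'.Nonempty) (hX' : X' ⊂ X)
    (hun : Unseparated (⋃ i, clSet (T i)) X') :
    ∀ i, (∃ e ∈ (T i).E, (T i).clusterBelow e.2 = X') ∨
      (∃ v : Fin (T i).n, ∃ F : Finset (Fin (T i).n × Fin (T i).n),
        F ⊆ ((T i).E.filter fun e => e.1 = v) ∧
        X' = F.sup fun e => (T i).clusterBelow e.2) := by
  intro i
  have hun' : Unseparated (clSet (T i)) X' := fun C hC => hun C (Set.mem_iUnion.2 ⟨i, hC⟩)
  have hN := (hT i).1
  generalize T i = N at hN hun' ⊢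
  obtain ⟨ρ, hρ, huniq⟩ := aux_root hN
  obtain ⟨hac, -, -, -, hbij⟩ := hN
  have : Std.Irrefl (Function.swap (Relation.TransGen N.Adj)) := ⟨hac⟩
  have : IsTrans _ (Function.swap (Relation.TransGen N.Adj)) :=
    ⟨fun a b c h1 h2 => Relation.TransGen.trans h2 h1⟩
  have wf : WellFounded (Function.swap (Relation.TransGen N.Adj)) :=
    Finite.wellFounded_of_trans_of_irrefl _
  have hroot : X ⊆ N.clusterBelow ρ := by
    intro x hx
    obtain ⟨w, hw, rfl⟩ := hbij.surjOn hx
    exact mem_clusterBelow.2 ⟨w, ⟨hρ w, hw⟩, rfl⟩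
  obtain ⟨v, hv, hmin⟩ := wf.has_min {v | X' ⊆ N.clusterBelow v} ⟨ρ, hX'.1.trans hroot⟩
  by_cases hleaf : N.IsLeaf v
  · left
    have hreach : ∀ w, N.Reaches v w → w = v := by
      intro w hw
      rcases Relation.ReflTransGen.cases_head hw with h | ⟨c, hc, -⟩
      · exact h.symm
      · have h0 := Finset.card_eq_zero.1 hleaf
        have : (v, c) ∈ N.E.filter fun e => e.1 = v := Finset.mem_filter.2 ⟨hc, rfl⟩
        rw [h0] at this
        simp at this
    have hcl : ∀ x ∈ N.clusterBelow v, x = N.label v := by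
      intro x hx
      obtain ⟨w, ⟨hw, -⟩, rfl⟩ := mem_clusterBelow.1 hx
      rw [hreach w hw]
    obtain ⟨y, hy⟩ := hne
    have hyv := hcl y (hv hy)
    have hsub : N.clusterBelow v ⊆ X' := by
      intro x hx
      rw [hcl x hx, ← hyv]; exact hy
    have hd : N.indeg v ≠ 0 := by
      intro h0
      have := huniq v h0
      subst this
      exact hX'.2 (hroot.trans hsub)
    obtain ⟨e, he⟩ := Finset.card_pos.1 (Nat.pos_of_ne_zero hd)
    rw [Finset.mem_filter] at he
    refine ⟨e, he.1, ?_⟩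
    rw [he.2]
    exact Finset.Subset.antisymm hsub hv
  · right
    refine ⟨v, (N.E.filter fun e => e.1 = v).filter fun e => N.clusterBelow e.2 ⊆ X',
      Finset.filter_subset _ _, ?_⟩
    apply Finset.Subset.antisymm
    · intro x hx
      obtain ⟨w, ⟨hw, hwl⟩, hwx⟩ := mem_clusterBelow.1 (hv hx)
      rcases Relation.ReflTransGen.cases_head hw with h | ⟨c, hc, hcw⟩
      · exact absurd (h ▸ hwl) hleaf
      · have hxc : x ∈ N.clusterBelow c := mem_clusterBelow.2 ⟨w, ⟨hcw, hwl⟩, hwx⟩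
        have hsub : N.clusterBelow c ⊆ X' := by
          rcases hun' (N.clusterBelow c) ⟨(v, c), hc, rfl⟩ with h | h | h
          · exact absurd (Finset.mem_inter.2 ⟨hxc, hx⟩) (by rw [h]; simp)
          · exact h
          · exact absurd (Relation.TransGen.single hc) (hmin c h)
        rw [Finset.mem_sup]
        exact ⟨(v, c), Finset.mem_filter.2 ⟨Finset.mem_filter.2 ⟨hc, rfl⟩, hsub⟩, hxc⟩
    · apply Finset.sup_le
      intro e he
      exact (Finset.mem_filter.1 he).2

end Phylo
end
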